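/- Let n ≥ 1 and let A be the n × n Cartan matrix of type Cₙ (the type of Sp(n)): A_{ii} = 2 for all i, A_{i,i+1} = A_{i+1,i} = −1 for 1 ≤ i ≤ n−2, A_{n−1,n} = −1, A_{n,n−1} = −2, and all other entries 0. Consider the linear map τ : (ℤ/2)ⁿ → (ℤ/2)ⁿ given by multiplication by the transpose Aᵗ (entries reduced mod 2). Then the standard basis vector e₁ does not lie in the range of τ, and the range of τ together with e₁ spans all of (ℤ/2)ⁿ; consequently the cokernel (ℤ/2)ⁿ / range(τ) is isomorphic to ℤ/2 and is generated by the class of e₁. -/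

import Mathlib

/-- The vector with a one in position `k` (zero if `k` is out of range). -/
def cnE (n k : ℕ) : Fin n → ZMod 2 := fun j => if (j : ℕ) = k then 1 else 0

/-- The sum of the coordinates with even (zero-based) index. -/
def cnF (n : ℕ) : (Fin n → ZMod 2) →ₗ[ZMod 2] ZMod 2 where
  toFun v := ∑ j : Fin n, if Even (j : ℕ) then v j else 0
  map_add' v w := by
    rw [← Finset.sum_add_distrib]
    refine Finset.sum_congr rfl fun j _ => ?_
    split_ifs <;> simp
  map_smul' c v := by
    simp [Finset.mul_sum]

theorem cnE_eq {n : ℕ} (j : Fin n) : Pi.single j (1 : ZMod 2) = cnE n j := by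
  funext k
  simp [cnE, Pi.single_apply, Fin.ext_iff]

theorem cnF_E {n k : ℕ} (hk : k < n) : cnF n (cnE n k) = if Even k then 1 else 0 := by
  have h : cnE n k = Pi.single (⟨k, hk⟩ : Fin n) (1 : ZMod 2) := (cnE_eq ⟨k, hk⟩).symm
  rw [h]
  change (∑ j : Fin n, if Even (j : ℕ) then _ else 0) = _
  rw [Finset.sum_eq_single (⟨k, hk⟩ : Fin n)]
  · simp
  · intro b _ hb
    simp [hb]
  · simp

theorem cn_main {n : ℕ} (hn : 1 ≤ n) (τ : (Fin n → ZMod 2) →ₗ[ZMod 2] (Fin n → ZMod 2))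
    (h0 : 1 < n → τ (cnE n 0) = cnE n 1)
    (h1 : ∀ i, i + 2 < n → τ (cnE n (i + 1)) = cnE n i + cnE n (i + 2))
    (h2 : τ (cnE n (n - 1)) = 0) :
    LinearMap.range τ = LinearMap.ker (cnF n) ∧
      ∀ v, v - cnF n v • cnE n 0 ∈ LinearMap.range τ := by
  have hle : LinearMap.range τ ≤ LinearMap.ker (cnF n) := by
    rw [LinearMap.range_le_ker_iff]
    refine LinearMap.pi_ext' fun j => LinearMap.ext_ring ?_
    change cnF n (τ (Pi.single j 1)) = 0
    rw [cnE_eq]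
    obtain ⟨j, hj⟩ := j
    change cnF n (τ (cnE n j)) = 0
    by_cases hl : j = n - 1
    · rw [hl, h2, map_zero]
    · rcases j with _ | j
      · rw [h0 (by omega), cnF_E (by omega)]; simp
      · rw [h1 j (by omega), map_add, cnF_E (by omega), cnF_E (by omega)]
        by_cases h : Even j
        · simp [h, Nat.even_add]; decide
        · simp [h, Nat.even_add]
  have key : ∀ j, (j < n → cnE n j - cnF n (cnE n j) • cnE n 0 ∈ LinearMap.range τ) ∧
      (j + 1 < n → cnE n (j + 1) - cnF n (cnE n (j + 1)) • cnE n 0 ∈ LinearMap.range τ) := by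
    intro j
    induction j with
    | zero =>
      refine ⟨fun h => ?_, fun h => ?_⟩
      · rw [cnF_E h]; simp
      · rw [cnF_E h]; exact ⟨cnE n 0, by simpa using h0 h⟩
    | succ j ih =>
      refine ⟨ih.2, fun h => ?_⟩
      have a := ih.1 (by omega)
      have b : cnE n j + cnE n (j + 2) ∈ LinearMap.range τ := ⟨_, h1 j h⟩
      have c := (LinearMap.range τ).sub_mem b a
      have hf : cnF n (cnE n (j + 2)) = - cnF n (cnE n j) := by
        have := hle b
        rw [LinearMap.mem_ker, map_add] at this
        exact (neg_eq_of_add_eq_zero_right this).symm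
      change cnE n (j + 2) - cnF n (cnE n (j + 2)) • cnE n 0 ∈ LinearMap.range τ
      rw [hf]
      convert c using 1
      module
  have all : ∀ v, v - cnF n v • cnE n 0 ∈ LinearMap.range τ := by
    intro v
    induction v using Pi.single_induction with
    | zero => simp
    | add f g hf hg =>
      convert (LinearMap.range τ).add_mem hf hg using 1
      rw [map_add]; module
    | single i m =>
      have : (Pi.single i m : Fin n → ZMod 2) = m • cnE n i := by
        rw [← cnE_eq, ← Pi.single_smul]; simp
      rw [this]
      convert (LinearMap.range τ).smul_mem m ((key i).1 i.2) using 1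
      rw [map_smul, smul_sub, smul_assoc]
  refine ⟨le_antisymm hle fun v hv => ?_, all⟩
  have := all v
  rwa [LinearMap.mem_ker.1 hv, zero_smul, sub_zero] at this

/-- For the Cartan matrix A of type Cₙ (the group Sp(n)) and the
linear map τ : (ℤ/2)ⁿ → (ℤ/2)ⁿ given by the mod 2 reduction of Aᵗ, the
standard basis vector e₁ is not in the range of τ, the range of τ together
with e₁ spans everything, and the cokernel (ℤ/2)ⁿ/range τ is isomorphic to
ℤ/2 and generated by the class of e₁. -/
theorem cartan_Cn_mod_two_transgression_cokernel
    {n : ℕ} (hn : 1 ≤ n) (A : Matrix (Fin n) (Fin n) ℤ)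
    (hA : ∀ i j : Fin n, A i j =
      if i = j then 2
      else if (j : ℕ) = (i : ℕ) + 1 then -1
      else if (i : ℕ) = (j : ℕ) + 1 then (if (i : ℕ) = n - 1 then -2 else -1)
      else 0) :
    Pi.single (⟨0, by omega⟩ : Fin n) (1 : ZMod 2) ∉
      LinearMap.range (Matrix.mulVecLin ((A.map (Int.cast : ℤ → ZMod 2)).transpose)) ∧
    Submodule.span (ZMod 2)
      ((LinearMap.range (Matrix.mulVecLin ((A.map (Int.cast : ℤ → ZMod 2)).transpose)) : Set (Fin n → ZMod 2))
        ∪ {Pi.single (⟨0, by omega⟩ : Fin n) (1 : ZMod 2)}) = ⊤ ∧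
    Nonempty
      (((Fin n → ZMod 2) ⧸
        LinearMap.range (Matrix.mulVecLin ((A.map (Int.cast : ℤ → ZMod 2)).transpose)))
        ≃ₗ[ZMod 2] ZMod 2) ∧
    Submodule.span (ZMod 2)
      {(Submodule.Quotient.mk (Pi.single (⟨0, by omega⟩ : Fin n) (1 : ZMod 2)) :
        (Fin n → ZMod 2) ⧸
          LinearMap.range (Matrix.mulVecLin ((A.map (Int.cast : ℤ → ZMod 2)).transpose)))} = ⊤ := by
  have row : ∀ i (hi : i < n) (k : Fin n),
      Matrix.mulVecLin ((A.map (Int.cast : ℤ → ZMod 2)).transpose) (cnE n i) k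
        = ((A ⟨i, hi⟩ k : ℤ) : ZMod 2) := by
    intro i hi k
    have h : cnE n i = Pi.single (⟨i, hi⟩ : Fin n) (1 : ZMod 2) := (cnE_eq ⟨i, hi⟩).symm
    rw [h]
    simp
  have t2 : (2 : ZMod 2) = 0 := by decide
  have t1 : (-1 : ZMod 2) = 1 := by decide
  obtain ⟨hr, hall⟩ := cn_main hn
    (Matrix.mulVecLin ((A.map (Int.cast : ℤ → ZMod 2)).transpose))
    (by
      intro h
      funext k
      rw [row 0 (by omega), hA]
      simp only [cnE, Fin.ext_iff]
      split_ifs <;> first | omega | contradiction | simp [t2, t1])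
    (by
      intro i h
      funext k
      rw [row (i + 1) (by omega), hA]
      simp only [cnE, Fin.ext_iff, Pi.add_apply]
      split_ifs <;> first | omega | contradiction | simp [t2, t1])
    (by
      funext k
      rw [row (n - 1) (by omega), hA]
      have := k.2
      simp only [Fin.ext_iff, Pi.zero_apply]
      split_ifs <;> first | omega | contradiction | simp [t2, t1])
  rw [cnE_eq]
  change cnE n 0 ∉ _ ∧ Submodule.span (ZMod 2) (_ ∪ {cnE n 0}) = ⊤ ∧ _ ∧
    Submodule.span (ZMod 2) {Submodule.Quotient.mk (cnE n 0)} = ⊤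
  generalize Matrix.mulVecLin ((A.map (Int.cast : ℤ → ZMod 2)).transpose) = τ at *
  have f0 : cnF n (cnE n 0) = 1 := by rw [cnF_E (by omega)]; simp
  refine ⟨?_, ?_, ?_, ?_⟩
  · rw [hr, LinearMap.mem_ker, f0]; decide
  · rw [eq_top_iff]
    intro v _
    rw [← sub_add_cancel v (cnF n v • cnE n 0)]
    exact Submodule.add_mem _ (Submodule.subset_span (Or.inl (hall v)))
      (Submodule.smul_mem _ _ (Submodule.subset_span (Or.inr rfl)))
  · rw [hr]
    refine ⟨(cnF n).quotKerEquivOfSurjective fun c => ⟨c • cnE n 0, ?_⟩⟩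
    rw [map_smul, f0]; simp
  · rw [eq_top_iff]
    intro q _
    obtain ⟨v, rfl⟩ := Submodule.Quotient.mk_surjective _ q
    rw [Submodule.mem_span_singleton]
    refine ⟨cnF n v, ?_⟩
    rw [← Submodule.Quotient.mk_smul]
    exact ((Submodule.Quotient.eq _).2 (hall v)).symm
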